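/- Let n ≥ 2 be an integer and ξ a transcendental real number. Then ŵ_n(ξ) ≤ n - 1/2 + sqrt(n² - 2n + 5/4). -/

import Mathlib

open Polynomial Filter

/-- Height of an integer polynomial: the maximum absolute value of its coefficients. -/
noncomputable def polyHeight (P : Polynomial ℤ) : ℝ :=
  ((P.support.sup fun i => (P.coeff i).natAbs : ℕ) : ℝ)

/-- `P` and `Q` have no common non-constant factor in `ℤ[X]`. -/
def CoprimePoly (P Q : Polynomial ℤ) : Prop :=
  ∀ d : Polynomial ℤ, d ∣ P → d ∣ Q → d.natDegree = 0

/-- The exponent `w_n(ξ)`. -/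
noncomputable def wExp (n : ℕ) (ξ : ℝ) : EReal :=
  sSup {x : EReal | ∃ w : ℝ, x = (w : EReal) ∧
    {P : Polynomial ℤ | P.natDegree ≤ n ∧ 0 < |Polynomial.aeval ξ P| ∧
      |Polynomial.aeval ξ P| ≤ (polyHeight P) ^ (-w)}.Infinite}

/-- The uniform exponent `ŵ_n(ξ)`. -/
noncomputable def whExp (n : ℕ) (ξ : ℝ) : EReal :=
  sSup {x : EReal | ∃ w : ℝ, x = (w : EReal) ∧
    ∀ᶠ H : ℝ in atTop, ∃ P : Polynomial ℤ, P.natDegree ≤ n ∧ polyHeight P ≤ H ∧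
      0 < |Polynomial.aeval ξ P| ∧ |Polynomial.aeval ξ P| ≤ H ^ (-w)}

/-- The exponent `w*_n(ξ)` of approximation by algebraic numbers of degree at most `n`;
the height of an algebraic number is the height of its irreducible defining polynomial. -/
noncomputable def wStarExp (n : ℕ) (ξ : ℝ) : EReal :=
  sSup {x : EReal | ∃ w : ℝ, x = (w : EReal) ∧
    {α : ℝ | ∃ P : Polynomial ℤ, Irreducible P ∧ Polynomial.aeval α P = 0 ∧
      P.natDegree ≤ n ∧ 0 < |ξ - α| ∧ |ξ - α| ≤ (polyHeight P) ^ (-w - 1)}.Infinite}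

/-- The uniform exponent `ŵ*_n(ξ)`. -/
noncomputable def whStarExp (n : ℕ) (ξ : ℝ) : EReal :=
  sSup {x : EReal | ∃ w : ℝ, x = (w : EReal) ∧
    ∀ᶠ H : ℝ in atTop, ∃ α : ℝ, ∃ P : Polynomial ℤ, Irreducible P ∧
      Polynomial.aeval α P = 0 ∧ P.natDegree ≤ n ∧ polyHeight P ≤ H ∧
      0 < |ξ - α| ∧ |ξ - α| ≤ (polyHeight P)⁻¹ * H ^ (-w)}

theorem abs_coeff_le_polyHeight (P : ℤ[X]) (i : ℕ) : |(P.coeff i : ℝ)| ≤ polyHeight P := by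
  by_cases h : i ∈ P.support
  · have := Finset.le_sup (f := fun i => (P.coeff i).natAbs) h
    rw [polyHeight, ← Int.cast_abs, Int.abs_eq_natAbs]
    exact_mod_cast this
  · simp [notMem_support_iff.mp h, polyHeight]

theorem polyHeight_le {P : ℤ[X]} {B : ℝ} (hB : 0 ≤ B) (h : ∀ i, |(P.coeff i : ℝ)| ≤ B) :
    polyHeight P ≤ B := by
  rw [polyHeight, ← Nat.le_floor_iff hB]
  refine Finset.sup_le fun i _ => Nat.le_floor ?_
  simpa [Nat.cast_natAbs] using h i

theorem polyHeight_nonneg (P : ℤ[X]) : 0 ≤ polyHeight P := Nat.cast_nonneg _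

theorem one_le_polyHeight {P : ℤ[X]} (hP : P ≠ 0) : 1 ≤ polyHeight P := by
  refine le_trans ?_ (abs_coeff_le_polyHeight P P.natDegree)
  rw [← Int.cast_abs]
  exact_mod_cast Int.one_le_abs (leadingCoeff_ne_zero.mpr hP)

theorem polyHeight_X_pow_mul_le (P : ℤ[X]) (k : ℕ) : polyHeight (X ^ k * P) ≤ polyHeight P := by
  refine polyHeight_le (polyHeight_nonneg P) fun i => ?_
  rw [coeff_X_pow_mul']
  split_ifs
  · exact abs_coeff_le_polyHeight P _
  · simpa using polyHeight_nonneg P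

theorem finite_natDegree_le_polyHeight_le (n : ℕ) (B : ℝ) :
    {P : ℤ[X] | P.natDegree ≤ n ∧ polyHeight P ≤ B}.Finite := by
  have hfin : (Set.univ.pi fun _ : Fin (n + 1) => Set.Icc (-⌈B⌉) ⌈B⌉).Finite :=
    Set.Finite.pi fun _ => Set.finite_Icc _ _
  refine Set.Finite.of_finite_image (f := fun P : ℤ[X] => fun i : Fin (n + 1) => P.coeff i)
    (hfin.subset ?_) ?_
  · rintro _ ⟨P, ⟨-, hP⟩, rfl⟩ i -
    have h := (abs_coeff_le_polyHeight P i).trans (hP.trans (Int.le_ceil B))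
    rw [← Int.cast_abs, Int.cast_le] at h
    exact abs_le.mp h
  · rintro P ⟨hP, -⟩ Q ⟨hQ, -⟩ h
    ext i
    by_cases hi : i < n + 1
    · exact congrFun h ⟨i, hi⟩
    · rw [coeff_eq_zero_of_natDegree_lt (by omega), coeff_eq_zero_of_natDegree_lt (by omega)]

theorem mahlerMeasure_le_polyHeight {n : ℕ} {P : ℤ[X]} (hP : P.natDegree ≤ n) :
    (P.map (Int.castRingHom ℂ)).mahlerMeasure ≤ (n + 1) * polyHeight P := by
  refine (mahlerMeasure_le_sum_norm_coeff _).trans ?_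
  rw [sum_over_range' _ (by simp) (n + 1) (by
    have := natDegree_map_le (f := Int.castRingHom ℂ) (p := P); omega)]
  refine (Finset.sum_le_card_nsmul _ _ (polyHeight P) fun i _ => ?_).trans (by simp)
  simpa using abs_coeff_le_polyHeight P i

theorem polyHeight_le_mahlerMeasure {n : ℕ} {P : ℤ[X]} (hP : P.natDegree ≤ n) :
    polyHeight P ≤ 2 ^ n * (P.map (Int.castRingHom ℂ)).mahlerMeasure := by
  have hM := (P.map (Int.castRingHom ℂ)).mahlerMeasure_nonneg
  refine polyHeight_le (by positivity) fun i => ?_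
  have h := norm_coeff_le_choose_mul_mahlerMeasure i (P.map (Int.castRingHom ℂ))
  have hd := natDegree_map_le (f := Int.castRingHom ℂ) (p := P)
  have hc : (((P.map (Int.castRingHom ℂ)).natDegree.choose i : ℕ) : ℝ) ≤ 2 ^ n := by
    exact_mod_cast (Nat.choose_le_two_pow _ _).trans (Nat.pow_le_pow_right two_pos (hd.trans hP))
  have : |(P.coeff i : ℝ)| = ‖(P.map (Int.castRingHom ℂ)).coeff i‖ := by simp
  rw [this]
  exact h.trans (by gcongr)

theorem polyHeight_mul_le {n : ℕ} {A B : ℤ[X]} (hA : A.natDegree ≤ n) (hB : B.natDegree ≤ n)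
    (hAB : (A * B).natDegree ≤ n) :
    polyHeight A * polyHeight B ≤ 4 ^ n * (n + 1) * polyHeight (A * B) := by
  have h1 := polyHeight_le_mahlerMeasure hA
  have h2 := polyHeight_le_mahlerMeasure hB
  have h3 := mahlerMeasure_le_polyHeight hAB
  rw [Polynomial.map_mul, mahlerMeasure_mul] at h3
  calc polyHeight A * polyHeight B
      ≤ (2 ^ n * (A.map (Int.castRingHom ℂ)).mahlerMeasure) *
        (2 ^ n * (B.map (Int.castRingHom ℂ)).mahlerMeasure) :=
        mul_le_mul h1 h2 (polyHeight_nonneg B) ((polyHeight_nonneg A).trans h1)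
    _ = 4 ^ n * ((A.map (Int.castRingHom ℂ)).mahlerMeasure *
        (B.map (Int.castRingHom ℂ)).mahlerMeasure) := by
        rw [show (4 : ℝ) = 2 * 2 by norm_num, mul_pow]; ring
    _ ≤ _ := by rw [mul_assoc]; gcongr

open Finset in
theorem abs_det_le_prod {ι : Type*} [Fintype ι] [DecidableEq ι] (A : Matrix ι ι ℝ) (h : ι → ℝ)
    (hA : ∀ i j, |A i j| ≤ h i) : |A.det| ≤ (Fintype.card ι).factorial * ∏ i, h i := by
  rw [← Matrix.det_transpose, Matrix.det_apply]
  refine (abs_sum_le_sum_abs _ _).trans ((sum_le_card_nsmul _ _ (∏ i, h i) fun σ _ => ?_).trans ?_)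
  · have : |((Equiv.Perm.sign σ : ℤˣ) • ∏ i, A.transpose (σ i) i)| = ∏ i, |A i (σ i)| := by
      rcases Int.units_eq_one_or (Equiv.Perm.sign σ) with h | h <;> simp [h, abs_prod]
    rw [this]
    exact prod_le_prod (fun _ _ => abs_nonneg _) fun i _ => hA i _
  · simp [Fintype.card_perm]

/-- A family of linearly independent integer polynomials whose cardinality bounds their degrees
cannot have too small heights and values at a real point. -/
theorem one_le_of_linearIndependent {ι : Type*} [Fintype ι] [Nonempty ι] {F : ι → ℤ[X]}
    (hdeg : ∀ i, (F i).natDegree < Fintype.card ι) (hind : LinearIndependent ℤ F) {ξ : ℝ}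
    {h e : ι → ℝ} {T : ℝ} (hh : ∀ i, polyHeight (F i) ≤ h i) (hone : ∀ i, 1 ≤ h i)
    (he : ∀ i, |aeval ξ (F i)| ≤ e i) (hT : ∀ i, e i * ∏ j, h j ≤ T * h i) :
    1 ≤ (Fintype.card ι).factorial * Fintype.card ι * T := by
  classical
  let σ : ι ≃ Fin (Fintype.card ι) := Fintype.equivFin ι
  let M : Matrix ι ι ℤ := fun i j => (F i).coeff (σ j)
  have hdet : M.det ≠ 0 := by
    intro h0
    obtain ⟨v, hv, hvM⟩ := Matrix.exists_vecMul_eq_zero_iff.mpr h0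
    refine hv (funext (Fintype.linearIndependent_iff.mp hind v ?_))
    ext m
    rw [finsetSum_coeff]
    by_cases hm : m < Fintype.card ι
    · have := congrFun hvM (σ.symm ⟨m, hm⟩)
      simpa [Matrix.vecMul, dotProduct, M] using this
    · refine Finset.sum_eq_zero fun i _ => ?_
      rw [coeff_smul, coeff_eq_zero_of_natDegree_lt (by have := hdeg i; omega), smul_zero]
  let R : Matrix ι ι ℝ := M.map (Int.cast)
  have hR : R.det = (M.det : ℝ) := (Int.cast_det M).symm
  have hone' : 1 ≤ |R.det| := by
    rw [hR, ← Int.cast_abs]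
    exact_mod_cast Int.one_le_abs hdet
  let v : ι → ℝ := fun j => ξ ^ (σ j : ℕ)
  have hval : ∀ i, R.mulVec v i = aeval ξ (F i) := by
    intro i
    rw [aeval_eq_sum_range' (hdeg i), Finset.sum_range]
    simp only [Matrix.mulVec, dotProduct, R, M, v, zsmul_eq_mul]
    exact Fintype.sum_equiv σ _ _ fun _ => rfl
  have hcard : 0 < Fintype.card ι := Fintype.card_pos
  let k : ι := σ.symm ⟨0, hcard⟩
  have hvk : v k = 1 := by simp [v, k]
  have hadj : R.det = ∑ i, R.adjugate k i * aeval ξ (F i) := by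
    have := congrFun (congrArg (fun A : Matrix ι ι ℝ => A.mulVec v) R.adjugate_mul) k
    simp only [Matrix.smul_mulVec, Matrix.one_mulVec, Pi.smul_apply, hvk, smul_eq_mul,
      mul_one] at this
    rw [← this, ← Matrix.mulVec_mulVec]
    simp [Matrix.mulVec, dotProduct, ← hval]
  have hentry : ∀ i, |R.adjugate k i * aeval ξ (F i)| ≤ (Fintype.card ι).factorial * T := by
    intro i
    have hpos : 0 < h i := one_pos.trans_le (hone i)
    have h1 : |R.adjugate k i| ≤ (Fintype.card ι).factorial *
        ∏ j, Function.update h i 1 j := by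
      rw [Matrix.adjugate_apply]
      refine abs_det_le_prod _ _ fun a b => ?_
      by_cases hai : a = i
      · subst hai
        by_cases hbk : b = k <;> simp [hbk]
      · rw [Matrix.updateRow_ne hai, Function.update_of_ne hai]
        exact (abs_coeff_le_polyHeight (F a) (σ b)).trans (hh a)
    have h2 : (∏ j, Function.update h i 1 j) * h i = ∏ j, h j := by
      rw [Finset.prod_update_of_mem (Finset.mem_univ i), one_mul, mul_comm,
        ← Finset.mul_prod_erase _ _ (Finset.mem_univ i), Finset.sdiff_singleton_eq_erase]
    have h3 : 0 ≤ ∏ j, Function.update h i 1 j := by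
      refine Finset.prod_nonneg fun j _ => ?_
      by_cases hj : j = i
      · simp [hj]
      · rw [Function.update_of_ne hj]; exact zero_le_one.trans (hone j)
    have h4 : (∏ j, Function.update h i 1 j) * e i ≤ T := by
      refine le_of_mul_le_mul_right ?_ hpos
      calc _ = e i * ∏ j, h j := by rw [← h2]; ring
        _ ≤ _ := hT i
    rw [abs_mul]
    calc _ ≤ ((Fintype.card ι).factorial * ∏ j, Function.update h i 1 j) * e i :=
          mul_le_mul h1 (he i) (abs_nonneg _) (by positivity)
      _ = (Fintype.card ι).factorial * ((∏ j, Function.update h i 1 j) * e i) := by ring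
      _ ≤ _ := by gcongr
  calc (1 : ℝ) ≤ |R.det| := hone'
    _ ≤ ∑ i, |R.adjugate k i * aeval ξ (F i)| := by
        rw [hadj]; exact Finset.abs_sum_le_sum_abs _ _
    _ ≤ Fintype.card ι • ((Fintype.card ι).factorial * T) :=
        Finset.sum_le_card_nsmul _ _ _ fun i _ => hentry i
    _ = _ := by rw [nsmul_eq_mul]; ring

theorem exists_sum_zsmul_X_pow_mul {a : ℕ} (g : Fin a → ℤ) : ∃ A : ℤ[X], A.degree < a ∧
    (∀ i : Fin a, A.coeff i = g i) ∧ ∀ Q : ℤ[X], ∑ i, g i • (X ^ (i : ℕ) * Q) = A * Q := by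
  refine ⟨∑ i, C (g i) * X ^ (i : ℕ), degree_sum_fin_lt g, fun i => ?_, fun Q => ?_⟩
  · simp [finsetSum_coeff, coeff_X_pow, Fin.val_inj]
  · rw [Finset.sum_mul]
    refine Finset.sum_congr rfl fun i _ => ?_
    rw [← C_mul', mul_assoc]

theorem Irreducible.eq_zero_of_mul_add_mul_eq_zero {Q P A B : ℤ[X]} (hQ : Irreducible Q)
    (hQP : ¬ Q ∣ P) (hB : B.degree < Q.degree) (h : A * Q + B * P = 0) : A = 0 ∧ B = 0 := by
  have hdvd : Q ∣ B * P := ⟨-A, by linear_combination h⟩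
  have hB0 : B = 0 :=
    eq_zero_of_dvd_of_degree_lt ((hQ.prime.dvd_or_dvd hdvd).resolve_right hQP) hB
  subst hB0
  simpa [hQ.ne_zero] using h

theorem abs_aeval_X_pow_mul_le (ξ : ℝ) (P : ℤ[X]) {i N : ℕ} (h : i ≤ N) :
    |aeval ξ (X ^ i * P)| ≤ max 1 |ξ| ^ N * |aeval ξ P| := by
  rw [map_mul, map_pow, aeval_X, abs_mul, abs_pow]
  gcongr
  calc |ξ| ^ i ≤ max 1 |ξ| ^ i := by gcongr; exact le_max_right _ _
    _ ≤ _ := pow_le_pow_right₀ (le_max_left _ _) h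

theorem exists_resultant_bound (m : ℕ) (ξ : ℝ) : ∃ C : ℝ, 0 < C ∧ ∀ (d : ℕ) (Q P : ℤ[X]),
    Irreducible Q → Q.natDegree = d + 1 → d ≤ m → P.natDegree ≤ m + 1 → ¬ Q ∣ P →
    1 ≤ C * (polyHeight Q ^ m * polyHeight P ^ (d + 1) * |aeval ξ Q| +
      polyHeight Q ^ (m + 1) * polyHeight P ^ d * |aeval ξ P|) := by
  refine ⟨(2 * m + 2).factorial * (2 * m + 2 : ℕ) * max 1 |ξ| ^ m, by positivity,
    fun d Q P hQ hQd hd hP hQP => ?_⟩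
  have hP0 : P ≠ 0 := fun h => hQP (h ▸ dvd_zero Q)
  have h1Q := one_le_polyHeight hQ.ne_zero
  have h1P := one_le_polyHeight hP0
  let F : Fin (m + 1) ⊕ Fin (d + 1) → ℤ[X] :=
    Sum.elim (fun i => X ^ (i : ℕ) * Q) (fun i => X ^ (i : ℕ) * P)
  let h : Fin (m + 1) ⊕ Fin (d + 1) → ℝ :=
    Sum.elim (fun _ => polyHeight Q) (fun _ => polyHeight P)
  let e : Fin (m + 1) ⊕ Fin (d + 1) → ℝ := Sum.elim (fun _ => max 1 |ξ| ^ m * |aeval ξ Q|)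
    (fun _ => max 1 |ξ| ^ m * |aeval ξ P|)
  have hind : LinearIndependent ℤ F := by
    rw [Fintype.linearIndependent_iff]
    intro g hg
    obtain ⟨A, -, hA, hAQ⟩ := exists_sum_zsmul_X_pow_mul fun i => g (Sum.inl i)
    obtain ⟨B, hBd, hB, hBP⟩ := exists_sum_zsmul_X_pow_mul fun i => g (Sum.inr i)
    have hsum : A * Q + B * P = 0 := by
      rw [← hAQ, ← hBP, ← hg, Fintype.sum_sum_type]
      rfl
    have hdeg : B.degree < Q.degree := by rwa [degree_eq_natDegree hQ.ne_zero, hQd]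
    obtain ⟨rfl, rfl⟩ := hQ.eq_zero_of_mul_add_mul_eq_zero hQP hdeg hsum
    rintro (i | i)
    · exact (hA i).symm
    · exact (hB i).symm
  have hprod : ∏ j, h j = polyHeight Q ^ (m + 1) * polyHeight P ^ (d + 1) := by
    simp [h, Fintype.prod_sum_type]
  have hcard : Fintype.card (Fin (m + 1) ⊕ Fin (d + 1)) = m + 1 + (d + 1) := by simp
  have key := one_le_of_linearIndependent (F := F) (ξ := ξ) (h := h) (e := e)
    (T := max 1 |ξ| ^ m * (polyHeight Q ^ m * polyHeight P ^ (d + 1) * |aeval ξ Q| +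
      polyHeight Q ^ (m + 1) * polyHeight P ^ d * |aeval ξ P|)) ?_ hind ?_ ?_ ?_ ?_
  · rw [hcard] at key
    refine key.trans ?_
    rw [mul_assoc _ (max 1 |ξ| ^ m)]
    have : m + 1 + (d + 1) ≤ 2 * m + 2 := by omega
    gcongr
  · rw [hcard]
    rintro (i | i)
    · refine natDegree_mul_le.trans_lt ?_
      rw [natDegree_X_pow]
      omega
    · refine natDegree_mul_le.trans_lt ?_
      rw [natDegree_X_pow]
      omega
  · rintro (i | i) <;> exact polyHeight_X_pow_mul_le _ _
  · rintro (i | i) <;> assumption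
  · rintro (i | i) <;> exact abs_aeval_X_pow_mul_le _ _ (by omega)
  · rw [hprod]
    rintro (i | i)
    · simp only [h, e, Sum.elim_inl]
      have : 0 ≤ max 1 |ξ| ^ m * (polyHeight Q ^ (m + 1) * polyHeight P ^ d * |aeval ξ P|) *
        polyHeight Q := by positivity
      linear_combination this
    · simp only [h, e, Sum.elim_inr]
      have : 0 ≤ max 1 |ξ| ^ m * (polyHeight Q ^ m * polyHeight P ^ (d + 1) * |aeval ξ Q|) *
        polyHeight P := by positivity
      linear_combination this

/-- If no nonzero multiple of `R` is an integral combination of `P` and `Q`, then one of the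
polynomials `X ^ l * R` is not a combination of the `X ^ i * P` and `X ^ i * Q`. -/
theorem exists_X_pow_mul_not_mem {m : ℕ} {P Q R : ℤ[X]} (hP : Irreducible P)
    (hPd : P.natDegree = m + 2) (hPQ : ¬ P ∣ Q)
    (hR : ∀ a b c : ℤ, a • P + b • Q + c • R = 0 → c = 0) :
    ∃ l ≤ m, ∀ (A B : ℤ[X]) (c : ℤ), A.natDegree ≤ m → B.natDegree ≤ m →
      A * P + B * Q + c • (X ^ l * R) = 0 → c = 0 := by
  by_cases h0 : ∀ (A B : ℤ[X]) (c : ℤ), A.natDegree ≤ m → B.natDegree ≤ m →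
      A * P + B * Q + c • (X ^ 0 * R) = 0 → c = 0
  · exact ⟨0, Nat.zero_le m, h0⟩
  push Not at h0
  obtain ⟨A, B, c, hA, hB, h, hc⟩ := h0
  rw [pow_zero, one_mul] at h
  have hd : 1 ≤ max A.natDegree B.natDegree := by
    by_contra hlt
    obtain ⟨a, rfl⟩ := natDegree_eq_zero.mp (show A.natDegree = 0 by omega)
    obtain ⟨b, rfl⟩ := natDegree_eq_zero.mp (show B.natDegree = 0 by omega)
    exact hc (hR a b c (by rw [← h, C_mul', C_mul']))
  obtain ⟨l, hl⟩ : ∃ l, max A.natDegree B.natDegree + l = m + 1 :=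
    ⟨m + 1 - max A.natDegree B.natDegree, by omega⟩
  refine ⟨l, by omega, fun A' B' c' hA' hB' h' => ?_⟩
  by_contra hc'
  have hzero : (C c' * (X ^ l * A) - C c * A') * P + (C c' * (X ^ l * B) - C c * B') * Q = 0 := by
    rw [← C_mul'] at h h'
    linear_combination C c' * X ^ l * h - C c * h'
  rw [add_comm, add_comm] at hzero
  have hdeg : (C c' * (X ^ l * B) - C c * B').degree < P.degree := by
    rw [degree_eq_natDegree hP.ne_zero, hPd]
    refine degree_le_natDegree.trans_lt ?_
    have h1 : (C c' * (X ^ l * B)).natDegree ≤ l + B.natDegree :=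
      (natDegree_C_mul_le _ _).trans (natDegree_mul_le.trans (by rw [natDegree_X_pow]))
    have h2 : (C c * B').natDegree ≤ B'.natDegree := natDegree_C_mul_le _ _
    have h3 := natDegree_sub_le (C c' * (X ^ l * B)) (C c * B')
    exact_mod_cast (by omega :
      (C c' * (X ^ l * B) - C c * B').natDegree < m + 2)
  obtain ⟨h1, h2⟩ := hP.eq_zero_of_mul_add_mul_eq_zero hPQ hdeg hzero
  have aux : ∀ D D' : ℤ[X], C c' * (X ^ l * D) - C c * D' = 0 → D'.natDegree ≤ m →
      D.natDegree = 0 ∨ D.natDegree + l ≤ m := by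
    intro D D' hD hD'
    by_cases hD0 : D = 0
    · left; simp [hD0]
    right
    have := congrArg natDegree (sub_eq_zero.mp hD)
    rw [natDegree_C_mul hc', natDegree_C_mul hc, natDegree_X_pow_mul _ hD0] at this
    omega
  have h3 := aux A A' h1 hA'
  have h4 := aux B B' h2 hB'
  omega

theorem exists_triple_bound (m : ℕ) (ξ : ℝ) : ∃ C : ℝ, 0 < C ∧ ∀ P Q R : ℤ[X],
    Irreducible P → P.natDegree = m + 2 → Q.natDegree ≤ m + 2 → R.natDegree ≤ m + 2 → ¬ P ∣ Q →
    (∀ a b c : ℤ, a • P + b • Q + c • R = 0 → c = 0) →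
    polyHeight P ≤ polyHeight Q → polyHeight Q ≤ polyHeight R →
    |aeval ξ Q| ≤ |aeval ξ P| → |aeval ξ R| ≤ |aeval ξ P| →
    1 ≤ C * (polyHeight R * polyHeight Q ^ (2 * m + 1) * |aeval ξ P|) := by
  refine ⟨(2 * m + 3).factorial * (2 * m + 3 : ℕ) * max 1 |ξ| ^ m, by positivity,
    fun P Q R hP hPd hQd hRd hPQ hR hPQh hQRh hQe hRe => ?_⟩
  obtain ⟨l, hl, hlR⟩ := exists_X_pow_mul_not_mem hP hPd hPQ hR
  have h1Q : 1 ≤ polyHeight Q := (one_le_polyHeight hP.ne_zero).trans hPQh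
  have h1R : 1 ≤ polyHeight R := h1Q.trans hQRh
  let F : (Fin (m + 1) ⊕ Fin (m + 1)) ⊕ Unit → ℤ[X] :=
    Sum.elim (Sum.elim (fun i => X ^ (i : ℕ) * P) (fun i => X ^ (i : ℕ) * Q))
      (fun _ => X ^ l * R)
  let h : (Fin (m + 1) ⊕ Fin (m + 1)) ⊕ Unit → ℝ :=
    Sum.elim (fun _ => polyHeight Q) (fun _ => polyHeight R)
  let e : (Fin (m + 1) ⊕ Fin (m + 1)) ⊕ Unit → ℝ := fun _ => max 1 |ξ| ^ m * |aeval ξ P|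
  have hind : LinearIndependent ℤ F := by
    rw [Fintype.linearIndependent_iff]
    intro g hg
    obtain ⟨A, hAd, hA, hAP⟩ := exists_sum_zsmul_X_pow_mul fun i => g (Sum.inl (Sum.inl i))
    obtain ⟨B, hBd, hB, hBQ⟩ := exists_sum_zsmul_X_pow_mul fun i => g (Sum.inl (Sum.inr i))
    have hsum : A * P + B * Q + g (Sum.inr ()) • (X ^ l * R) = 0 := by
      rw [← hAP, ← hBQ, ← hg, Fintype.sum_sum_type, Fintype.sum_sum_type]
      simp [F]
    have hc : g (Sum.inr ()) = 0 := hlR A B _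
      (natDegree_le_iff_coeff_eq_zero.mpr fun N hN => (degree_lt_iff_coeff_zero _ _).mp hAd N hN)
      (natDegree_le_iff_coeff_eq_zero.mpr fun N hN => (degree_lt_iff_coeff_zero _ _).mp hBd N hN) hsum
    rw [hc, zero_smul, add_zero] at hsum
    have hdeg : B.degree < P.degree := by
      rw [degree_eq_natDegree hP.ne_zero, hPd]
      exact hBd.trans (by exact_mod_cast Nat.lt_succ_self _)
    obtain ⟨rfl, rfl⟩ := hP.eq_zero_of_mul_add_mul_eq_zero hPQ hdeg hsum
    rintro ((i | i) | i)
    · exact (hA i).symm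
    · exact (hB i).symm
    · exact hc
  have hprod : ∏ j, h j = polyHeight Q ^ (2 * m + 2) * polyHeight R := by
    simp only [h, Fintype.prod_sum_type, Sum.elim_inl, Sum.elim_inr, Finset.prod_const,
      Finset.card_univ, Fintype.card_sum, Fintype.card_fin, Fintype.card_unit]
    ring
  have hcard : Fintype.card ((Fin (m + 1) ⊕ Fin (m + 1)) ⊕ Unit) = 2 * m + 3 := by
    simp
    omega
  have key := one_le_of_linearIndependent (F := F) (ξ := ξ) (h := h) (e := e)
    (T := max 1 |ξ| ^ m * (polyHeight R * polyHeight Q ^ (2 * m + 1) * |aeval ξ P|))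
    ?_ hind ?_ ?_ ?_ ?_
  · rw [hcard] at key
    exact key.trans_eq (by ring)
  · rw [hcard]
    rintro ((i | i) | i) <;>
    · refine natDegree_mul_le.trans_lt ?_
      rw [natDegree_X_pow]
      omega
  · rintro ((i | i) | i)
    · exact (polyHeight_X_pow_mul_le _ _).trans hPQh
    · exact polyHeight_X_pow_mul_le _ _
    · exact polyHeight_X_pow_mul_le _ _
  · rintro ((i | i) | i) <;> assumption
  · rintro ((i | i) | i)
    · exact abs_aeval_X_pow_mul_le _ _ (by omega)
    · exact (abs_aeval_X_pow_mul_le ξ Q (Nat.lt_succ_iff.mp i.2)).trans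
        (mul_le_mul_of_nonneg_left hQe (by positivity))
    · exact (abs_aeval_X_pow_mul_le ξ R hl).trans
        (mul_le_mul_of_nonneg_left hRe (by positivity))
  · rw [hprod]
    rintro (i | i)
    · simp only [h, e, Sum.elim_inl]
      exact le_of_eq (by ring)
    · simp only [h, e, Sum.elim_inr]
      calc max 1 |ξ| ^ m * |aeval ξ P| * (polyHeight Q ^ (2 * m + 2) * polyHeight R)
          = max 1 |ξ| ^ m * (polyHeight R * polyHeight Q ^ (2 * m + 1) * |aeval ξ P|) *
            polyHeight Q := by ring
        _ ≤ _ := by gcongr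

theorem exists_pos_le_abs_aeval {ξ : ℝ} (hξ : ∀ P : ℤ[X], P ≠ 0 → aeval ξ P ≠ 0) (n : ℕ) (B : ℝ) :
    ∃ c : ℝ, 0 < c ∧ ∀ P : ℤ[X], P ≠ 0 → P.natDegree ≤ n → polyHeight P ≤ B →
      c ≤ |aeval ξ P| := by
  have hfin := (finite_natDegree_le_polyHeight_le n B).subset
    (Set.sep_subset _ fun P : ℤ[X] => P ≠ 0)
  rcases Set.eq_empty_or_nonempty
    {P ∈ {P : ℤ[X] | P.natDegree ≤ n ∧ polyHeight P ≤ B} | P ≠ 0} with h | h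
  · refine ⟨1, one_pos, fun P h0 hn hB => ?_⟩
    exact (Set.eq_empty_iff_forall_notMem.mp h P ⟨⟨hn, hB⟩, h0⟩).elim
  · obtain ⟨Q, hQ, hmin⟩ := Set.exists_min_image _ (fun P : ℤ[X] => |aeval ξ P|) hfin h
    exact ⟨_, abs_pos.mpr (hξ Q hQ.2), fun P h0 hn hB => hmin P ⟨⟨hn, hB⟩, h0⟩⟩

theorem polyHeight_primPart_le {P : ℤ[X]} (hP : P ≠ 0) :
    polyHeight P.primPart ≤ polyHeight P := by
  refine polyHeight_le (polyHeight_nonneg P) fun i => ?_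
  refine le_trans ?_ (abs_coeff_le_polyHeight P i)
  conv_rhs => rw [P.eq_C_content_mul_primPart, coeff_C_mul]
  have h1 : (1 : ℝ) ≤ |(P.content : ℝ)| := by
    rw [← Int.cast_abs]
    exact_mod_cast Int.one_le_abs (mt content_eq_zero_iff.mp hP)
  rw [Int.cast_mul, abs_mul]
  exact le_mul_of_one_le_left (abs_nonneg _) h1

theorem abs_aeval_primPart_mul (ξ : ℝ) (P : ℤ[X]) :
    |(P.content : ℝ)| * |aeval ξ P.primPart| = |aeval ξ P| := by
  conv_rhs => rw [P.eq_C_content_mul_primPart, map_mul, aeval_C, abs_mul]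
  simp

theorem abs_aeval_primPart_le (ξ : ℝ) {P : ℤ[X]} (hP : P ≠ 0) :
    |aeval ξ P.primPart| ≤ |aeval ξ P| := by
  rw [← abs_aeval_primPart_mul ξ P]
  refine le_mul_of_one_le_left (abs_nonneg _) ?_
  rw [← Int.cast_abs]
  exact_mod_cast Int.one_le_abs (mt content_eq_zero_iff.mp hP)

theorem exists_lower_bound_of_not_irreducible {ξ : ℝ} {d : ℕ} {w c : ℝ} (hw : 0 ≤ w) (hc : 0 < c)
    (h : ∀ P : ℤ[X], P ≠ 0 → P.natDegree ≤ d → c * polyHeight P ^ (-w) ≤ |aeval ξ P|) :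
    ∃ c' : ℝ, 0 < c' ∧ ∀ P : ℤ[X], P.IsPrimitive → P.natDegree = d + 1 → ¬ Irreducible P →
      c' * polyHeight P ^ (-w) ≤ |aeval ξ P| := by
  refine ⟨c * c * (4 ^ (d + 1) * ((d + 1 : ℕ) + 1) : ℝ) ^ (-w), by positivity,
    fun P hP hd hirr => ?_⟩
  have hunit : ¬ IsUnit P := fun hu => by
    have := natDegree_eq_zero_of_isUnit hu
    omega
  rw [irreducible_iff] at hirr
  push Not at hirr
  obtain ⟨A, B, rfl, hA, hB⟩ := hirr hunit
  have h0 : A * B ≠ 0 := hP.ne_zero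
  have hA0 := left_ne_zero_of_mul h0
  have hB0 := right_ne_zero_of_mul h0
  have hpos : ∀ D : ℤ[X], D ∣ A * B → ¬ IsUnit D → D.natDegree ≠ 0 := by
    intro D hD hu hzero
    obtain ⟨a, rfl⟩ := natDegree_eq_zero.mp hzero
    exact hu (isUnit_C.mpr (hP a hD))
  have hAd := hpos A (dvd_mul_right A B) hA
  have hBd := hpos B (dvd_mul_left B A) hB
  have hdeg := natDegree_mul hA0 hB0
  have hAB := polyHeight_mul_le (n := d + 1) (A := A) (B := B) (by omega) (by omega) hd.le
  have h1A := one_le_polyHeight hA0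
  have h1B := one_le_polyHeight hB0
  have h1 := h A hA0 (by omega)
  have h2 := h B hB0 (by omega)
  rw [map_mul, abs_mul]
  calc c * c * (4 ^ (d + 1) * ((d + 1 : ℕ) + 1) : ℝ) ^ (-w) * polyHeight (A * B) ^ (-w)
      = c * c * (4 ^ (d + 1) * ((d + 1 : ℕ) + 1) * polyHeight (A * B)) ^ (-w) := by
        rw [Real.mul_rpow (by positivity) (polyHeight_nonneg _)]; ring
    _ ≤ c * c * (polyHeight A * polyHeight B) ^ (-w) := by
        gcongr c * c * ?_
        exact Real.rpow_le_rpow_of_nonpos (by positivity) hAB (by linarith)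
    _ = (c * polyHeight A ^ (-w)) * (c * polyHeight B ^ (-w)) := by
        rw [Real.mul_rpow (by positivity) (by positivity)]; ring
    _ ≤ _ := by gcongr

theorem exists_lower_bound_of_irreducible {m : ℕ} {ξ y w : ℝ}
    (hξ : ∀ P : ℤ[X], P ≠ 0 → aeval ξ P ≠ 0)
    (hU : ∀ᶠ H : ℝ in atTop, ∃ P : ℤ[X], P.natDegree ≤ m + 2 ∧ polyHeight P ≤ H ∧
      0 < |aeval ξ P| ∧ |aeval ξ P| ≤ H ^ (-y)) (hw : 2 * (m : ℝ) + 2 < w) (hwy : w ≤ y)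
    {d : ℕ} (hd : d ≤ m) :
    ∃ c : ℝ, 0 < c ∧ ∀ Q : ℤ[X], Irreducible Q → Q.natDegree = d + 1 →
      c * polyHeight Q ^ (-w) ≤ |aeval ξ Q| := by
  obtain ⟨C, hC, hres⟩ := exists_resultant_bound (m + 1) ξ
  have hw0 : 0 < w := by have := m.cast_nonneg (α := ℝ); linarith
  set K : ℝ := 4 ^ (m + 2) * ((m + 2 : ℕ) + 1) with hK
  have hK0 : 0 < K := by positivity
  have hK1 : 1 ≤ 2 * K := by
    have h1 : (1 : ℝ) ≤ 4 ^ (m + 2) := one_le_pow₀ (by norm_num)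
    have h2 : (1 : ℝ) ≤ (m + 2 : ℕ) + 1 := by simp; positivity
    nlinarith
  have hdiv : Tendsto (fun H : ℝ => H / (2 * K)) atTop atTop :=
    tendsto_id.atTop_div_const (by positivity)
  have hsmall : ∀ᶠ H : ℝ in atTop, C * ((2 * K) ^ w * H ^ (-(w - (2 * m + 2)))) ≤ 1 / 2 := by
    have := ((tendsto_rpow_neg_atTop (sub_pos.mpr hw)).const_mul ((2 * K) ^ w)).const_mul C
    rw [mul_zero, mul_zero] at this
    exact this.eventually_le_const (by norm_num)
  obtain ⟨H₁, hH₁⟩ := eventually_atTop.mp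
    ((hdiv.eventually hU).and ((hdiv.eventually_ge_atTop 1).and hsmall))
  obtain ⟨c, hc, hbdd⟩ := exists_pos_le_abs_aeval hξ (m + 1) H₁
  refine ⟨min c (1 / (2 * C)), by positivity, fun Q hQ hQd => ?_⟩
  have h1Q := one_le_polyHeight hQ.ne_zero
  rcases le_total (polyHeight Q) H₁ with hle | hge
  · calc min c (1 / (2 * C)) * polyHeight Q ^ (-w) ≤ c * 1 := by
          gcongr
          · exact min_le_left _ _
          · exact Real.rpow_le_one_of_one_le_of_nonpos h1Q (by linarith)
      _ ≤ _ := by rw [mul_one]; exact hbdd Q hQ.ne_zero (by omega) hle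
  · obtain ⟨⟨P, hPd, hPH, hPpos, hPle⟩, hX1, hsm⟩ := hH₁ _ hge
    have hP0 : P ≠ 0 := by rintro rfl; simp at hPpos
    have h1P := one_le_polyHeight hP0
    set H := polyHeight Q with hH
    have hQP : ¬ Q ∣ P := by
      rintro ⟨B, rfl⟩
      have hB0 := right_ne_zero_of_mul hP0
      have hdeg := natDegree_mul hQ.ne_zero hB0
      have h1 := polyHeight_mul_le (n := m + 2) (A := Q) (B := B) (by omega) (by omega) hPd
      have h2 : H * 1 ≤ H * polyHeight B := by gcongr; exact one_le_polyHeight hB0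
      have h3 : K * polyHeight (Q * B) ≤ K * (H / (2 * K)) := by gcongr
      have h4 : K * (H / (2 * K)) = H / 2 := by field_simp
      linarith
    have hXH : H / (2 * K) ≤ H := div_le_self (by linarith) hK1
    have key := hres d Q P hQ hQd (by omega) (by omega) hQP
    have hPval : |aeval ξ P| ≤ (2 * K) ^ w * H ^ (-w) := by
      calc |aeval ξ P| ≤ (H / (2 * K)) ^ (-y) := hPle
        _ ≤ (H / (2 * K)) ^ (-w) := Real.rpow_le_rpow_of_exponent_le hX1 (by linarith)
        _ = _ := by
          rw [Real.div_rpow (by linarith) (by positivity), Real.rpow_neg (x := 2 * K)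
            (by positivity), div_inv_eq_mul, mul_comm]
    have hHP : polyHeight P ≤ H := hPH.trans hXH
    have hpow : ∀ k, k ≤ m + d + 2 → H ^ k ≤ H ^ (2 * m + 2) := fun k hk =>
      pow_le_pow_right₀ h1Q (by omega)
    have hA : H ^ (m + 1) * polyHeight P ^ (d + 1) * |aeval ξ Q| ≤
        H ^ (2 * m + 2) * |aeval ξ Q| := by
      gcongr
      calc _ ≤ H ^ (m + 1) * H ^ (d + 1) := by gcongr
        _ = H ^ (m + d + 2) := by ring
        _ ≤ _ := hpow _ le_rfl
    have hB : H ^ (m + 1 + 1) * polyHeight P ^ d * |aeval ξ P| ≤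
        (2 * K) ^ w * H ^ (-(w - (2 * m + 2))) := by
      calc _ ≤ H ^ (2 * m + 2) * ((2 * K) ^ w * H ^ (-w)) := by
            refine mul_le_mul ?_ hPval (abs_nonneg _) (by positivity)
            calc _ ≤ H ^ (m + 1 + 1) * H ^ d := by gcongr
              _ = H ^ (m + d + 2) := by ring
              _ ≤ _ := hpow _ le_rfl
        _ = (2 * K) ^ w * (H ^ ((2 * m + 2 : ℕ) : ℝ) * H ^ (-w)) := by
            rw [Real.rpow_natCast]; ring
        _ = _ := by
            rw [← Real.rpow_add (by linarith)]
            push_cast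
            ring_nf
    have hfin : 1 / 2 ≤ C * (H ^ (2 * m + 2) * |aeval ξ Q|) := by
      have h5 : C * (H ^ (m + 1) * polyHeight P ^ (d + 1) * |aeval ξ Q| +
          H ^ (m + 1 + 1) * polyHeight P ^ d * |aeval ξ P|) ≤
          C * (H ^ (2 * m + 2) * |aeval ξ Q| + (2 * K) ^ w * H ^ (-(w - (2 * m + 2)))) := by
        gcongr
      linarith
    have hHpow : H ^ (-w) * H ^ (2 * m + 2) ≤ 1 := by
      rw [← Real.rpow_natCast, ← Real.rpow_add (by linarith)]
      exact Real.rpow_le_one_of_one_le_of_nonpos h1Q (by push_cast; linarith)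
    calc min c (1 / (2 * C)) * H ^ (-w) ≤ 1 / (2 * C) * H ^ (-w) := by
          gcongr; exact min_le_right _ _
      _ = (1 / C) * H ^ (-w) * (1 / 2) := by field_simp
      _ ≤ (1 / C) * H ^ (-w) * (C * (H ^ (2 * m + 2) * |aeval ξ Q|)) := by gcongr
      _ = (H ^ (-w) * H ^ (2 * m + 2)) * |aeval ξ Q| := by field_simp
      _ ≤ _ := mul_le_of_le_one_left (abs_nonneg _) hHpow

theorem exists_lower_bound_of_natDegree_le {m : ℕ} {ξ y w : ℝ}
    (hξ : ∀ P : ℤ[X], P ≠ 0 → aeval ξ P ≠ 0)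
    (hU : ∀ᶠ H : ℝ in atTop, ∃ P : ℤ[X], P.natDegree ≤ m + 2 ∧ polyHeight P ≤ H ∧
      0 < |aeval ξ P| ∧ |aeval ξ P| ≤ H ^ (-y)) (hw : 2 * (m : ℝ) + 2 < w) (hwy : w ≤ y)
    (d : ℕ) (hd : d ≤ m + 1) :
    ∃ c : ℝ, 0 < c ∧ ∀ P : ℤ[X], P ≠ 0 → P.natDegree ≤ d →
      c * polyHeight P ^ (-w) ≤ |aeval ξ P| := by
  have hw0 : 0 < w := by have := m.cast_nonneg (α := ℝ); linarith
  induction d with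
  | zero =>
    refine ⟨1, one_pos, fun P hP hdeg => ?_⟩
    rw [one_mul]
    refine (Real.rpow_le_one_of_one_le_of_nonpos (one_le_polyHeight hP) (by linarith)).trans ?_
    obtain ⟨a, rfl⟩ := natDegree_eq_zero.mp (Nat.le_zero.mp hdeg)
    rw [aeval_C, algebraMap_int_eq, eq_intCast, ← Int.cast_abs]
    exact_mod_cast Int.one_le_abs (by rintro rfl; simp at hP)
  | succ d ih =>
    obtain ⟨c₀, hc₀, h₀⟩ := ih (by omega)
    obtain ⟨c₁, hc₁, h₁⟩ := exists_lower_bound_of_not_irreducible hw0.le hc₀ h₀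
    obtain ⟨c₂, hc₂, h₂⟩ := exists_lower_bound_of_irreducible hξ hU hw hwy
      (Nat.succ_le_succ_iff.mp hd)
    refine ⟨min c₀ (min c₁ c₂), by positivity, fun P hP hdeg => ?_⟩
    have hrpow : 0 ≤ polyHeight P ^ (-w) := Real.rpow_nonneg (polyHeight_nonneg P) _
    rcases Nat.lt_or_ge P.natDegree (d + 1) with hlt | hge
    · exact (mul_le_mul_of_nonneg_right (min_le_left _ _) hrpow).trans
        (h₀ P hP (Nat.lt_succ_iff.mp hlt))
    have hprim : min c₁ c₂ * polyHeight P.primPart ^ (-w) ≤ |aeval ξ P.primPart| := by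
      have hnn : 0 ≤ polyHeight P.primPart ^ (-w) := Real.rpow_nonneg (polyHeight_nonneg _) _
      have hdeg' : P.primPart.natDegree = d + 1 := by
        rw [natDegree_primPart]; omega
      by_cases hirr : Irreducible P.primPart
      · exact (mul_le_mul_of_nonneg_right (min_le_right _ _) hnn).trans (h₂ _ hirr hdeg')
      · exact (mul_le_mul_of_nonneg_right (min_le_left _ _) hnn).trans
          (h₁ _ P.isPrimitive_primPart hdeg' hirr)
    have h1 : 0 < polyHeight P.primPart :=
      one_pos.trans_le (one_le_polyHeight P.isPrimitive_primPart.ne_zero)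
    refine le_trans ?_ (hprim.trans (abs_aeval_primPart_le ξ hP))
    gcongr ?_ * ?_
    · exact min_le_right _ _
    · exact Real.rpow_le_rpow_of_nonpos h1 (polyHeight_primPart_le hP) (by linarith)

/-- A sequence of best approximations: the values at `ξ` decrease, the heights increase, and
`f (k + 1)` has minimal height among the polynomials of degree at most `n` whose value is smaller
than that of `f k`. -/
structure IsMinimalSeq (n : ℕ) (ξ : ℝ) (f : ℕ → ℤ[X]) : Prop where
  ne_zero : ∀ k, f k ≠ 0
  natDegree_le : ∀ k, (f k).natDegree ≤ n
  abs_aeval_le : ∀ k (R : ℤ[X]), R ≠ 0 → R.natDegree ≤ n → polyHeight R ≤ polyHeight (f k) →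
    |aeval ξ (f k)| ≤ |aeval ξ R|
  abs_aeval_lt : ∀ k, |aeval ξ (f (k + 1))| < |aeval ξ (f k)|
  abs_aeval_le_of_lt : ∀ k (R : ℤ[X]), R ≠ 0 → R.natDegree ≤ n →
    polyHeight R < polyHeight (f (k + 1)) → |aeval ξ (f k)| ≤ |aeval ξ R|

namespace IsMinimalSeq

theorem polyHeight_lt {n : ℕ} {ξ : ℝ} {f : ℕ → ℤ[X]} (hf : IsMinimalSeq n ξ f) (k : ℕ) :
    polyHeight (f k) < polyHeight (f (k + 1)) := by
  by_contra! h
  exact (hf.abs_aeval_lt k).not_ge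
    (hf.abs_aeval_le k _ (hf.ne_zero _) (hf.natDegree_le _) h)

theorem tendsto_polyHeight {n : ℕ} {ξ : ℝ} {f : ℕ → ℤ[X]} (hf : IsMinimalSeq n ξ f) :
    Tendsto (fun k => polyHeight (f k)) atTop atTop := by
  refine tendsto_atTop_mono (fun k => ?_) tendsto_natCast_atTop_atTop
  induction k with
  | zero => simpa using polyHeight_nonneg _
  | succ k ih =>
    have h := hf.polyHeight_lt k
    simp only [polyHeight, Nat.cast_lt, Nat.cast_le] at h ih ⊢
    omega

theorem eventually_abs_aeval_le {n : ℕ} {ξ y : ℝ} {f : ℕ → ℤ[X]} (hf : IsMinimalSeq n ξ f)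
    (hU : ∀ᶠ H : ℝ in atTop, ∃ P : ℤ[X], P.natDegree ≤ n ∧ polyHeight P ≤ H ∧
      0 < |aeval ξ P| ∧ |aeval ξ P| ≤ H ^ (-y)) :
    ∀ᶠ k in atTop, |aeval ξ (f k)| ≤ 2 ^ y * polyHeight (f (k + 1)) ^ (-y) := by
  have htend : Tendsto (fun k => polyHeight (f (k + 1)) / 2) atTop atTop :=
    ((tendsto_add_atTop_iff_nat 1).mpr hf.tendsto_polyHeight).atTop_div_const two_pos
  filter_upwards [htend.eventually hU] with k ⟨R, hRd, hRH, hRpos, hRle⟩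
  have h1 := one_le_polyHeight (hf.ne_zero (k + 1))
  refine (hf.abs_aeval_le_of_lt k R (by rintro rfl; simp at hRpos) hRd (by linarith)).trans
    (hRle.trans_eq ?_)
  rw [Real.div_rpow (by linarith) two_pos.le, Real.rpow_neg two_pos.le, div_inv_eq_mul, mul_comm]

end IsMinimalSeq

theorem exists_minimal_of_abs_aeval_lt {n : ℕ} {ξ v : ℝ}
    (h : ∃ P : ℤ[X], P ≠ 0 ∧ P.natDegree ≤ n ∧ |aeval ξ P| < v) :
    ∃ P : ℤ[X], P ≠ 0 ∧ P.natDegree ≤ n ∧ |aeval ξ P| < v ∧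
      (∀ R : ℤ[X], R ≠ 0 → R.natDegree ≤ n → polyHeight R ≤ polyHeight P →
        |aeval ξ P| ≤ |aeval ξ R|) ∧
      ∀ R : ℤ[X], R ≠ 0 → R.natDegree ≤ n → polyHeight R < polyHeight P → v ≤ |aeval ξ R| := by
  obtain ⟨P₀, h₀, hd₀, hv₀⟩ := h
  let S : ℝ → Set ℤ[X] := fun B =>
    {R ∈ {R : ℤ[X] | R.natDegree ≤ n ∧ polyHeight R ≤ B} | R ≠ 0 ∧ |aeval ξ R| < v}
  have hS : ∀ B, (S B).Finite := fun B =>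
    (finite_natDegree_le_polyHeight_le n B).subset (Set.sep_subset _ _)
  obtain ⟨P₁, ⟨⟨hd₁, hB₁⟩, h₁, hv₁⟩, hmin₁⟩ := Set.exists_min_image (S (polyHeight P₀)) polyHeight
    (hS _) ⟨P₀, ⟨hd₀, le_rfl⟩, h₀, hv₀⟩
  obtain ⟨P₂, ⟨⟨hd₂, hB₂⟩, h₂, hv₂⟩, hmin₂⟩ := Set.exists_min_image (S (polyHeight P₁))
    (fun R => |aeval ξ R|) (hS _) ⟨P₁, ⟨hd₁, le_rfl⟩, h₁, hv₁⟩
  refine ⟨P₂, h₂, hd₂, hv₂, fun R hR hRd hRH => ?_, fun R hR hRd hRH => ?_⟩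
  · by_contra! hlt
    exact hlt.not_ge (hmin₂ R ⟨⟨hRd, hRH.trans hB₂⟩, hR, hlt.trans hv₂⟩)
  · by_contra! hlt
    have := hmin₁ R ⟨⟨hRd, (hRH.le.trans hB₂).trans hB₁⟩, hR, hlt⟩
    linarith

theorem exists_isMinimalSeq {n : ℕ} {ξ : ℝ} (hξ : ∀ P : ℤ[X], P ≠ 0 → aeval ξ P ≠ 0)
    (h : ∀ v : ℝ, 0 < v → ∃ P : ℤ[X], P ≠ 0 ∧ P.natDegree ≤ n ∧ |aeval ξ P| < v) :
    ∃ f : ℕ → ℤ[X], IsMinimalSeq n ξ f := by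
  choose! g hg0 hgd hgv hgm hgl using fun v hv => exists_minimal_of_abs_aeval_lt (h v hv)
  let f : ℕ → ℤ[X] := fun k => Nat.rec (g 1) (fun _ P => g |aeval ξ P|) k
  have hex : ∀ k, ∃ v : ℝ, 0 < v ∧ f k = g v := by
    intro k
    induction k with
    | zero => exact ⟨1, one_pos, rfl⟩
    | succ k ih =>
      obtain ⟨v, hv, hk⟩ := ih
      exact ⟨|aeval ξ (f k)|, abs_pos.mpr (hξ _ (hk ▸ hg0 v hv)), rfl⟩
  have h0 : ∀ k, f k ≠ 0 := fun k => by
    obtain ⟨v, hv, hk⟩ := hex k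
    exact hk ▸ hg0 v hv
  have hpos : ∀ k, 0 < |aeval ξ (f k)| := fun k => abs_pos.mpr (hξ _ (h0 k))
  refine ⟨f, h0, fun k => ?_, fun k => ?_, fun k => hgv _ (hpos k), fun k => hgl _ (hpos k)⟩
  · obtain ⟨v, hv, hk⟩ := hex k
    exact hk ▸ hgd v hv
  · obtain ⟨v, hv, hk⟩ := hex k
    exact hk ▸ hgm v hv

open Topology in
theorem exists_independent_triple {f : ℕ → ℤ[X]} {ξ : ℝ} (hξ : ∀ k, aeval ξ (f k) ≠ 0)
    (hprop : ∀ k, ∀ b c : ℤ, b • f k + c • f (k + 1) = 0 → c = 0)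
    (hH : ∀ k, polyHeight (f k) ≤ polyHeight (f (k + 1)))
    (hL : ∀ k, |aeval ξ (f (k + 1))| ≤ |aeval ξ (f k)|)
    (hlim : Tendsto (fun k => polyHeight (f (k + 1)) * |aeval ξ (f k)|) atTop (𝓝 0)) :
    ∃ k, ∀ a b c : ℤ, a • f k + b • f (k + 1) + c • f (k + 2) = 0 → c = 0 := by
  by_contra! hcon
  choose a b c hrel hc using hcon
  let D : ℕ → ℕ → ℕ → ℤ := fun i j k =>
    (f k).coeff i * (f (k + 1)).coeff j - (f k).coeff j * (f (k + 1)).coeff i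
  let E : ℕ → ℕ → ℝ := fun j k =>
    aeval ξ (f k) * (f (k + 1)).coeff j - aeval ξ (f (k + 1)) * (f k).coeff j
  have ha : ∀ k, a k ≠ 0 := fun k h0 => hc k (hprop (k + 1) (b k) (c k) (by
    simpa [h0] using hrel k))
  have hcoeff : ∀ k i, a k * (f k).coeff i + b k * (f (k + 1)).coeff i +
      c k * (f (k + 2)).coeff i = 0 := fun k i => by
    simpa using congrArg (fun P => coeff P i) (hrel k)
  have hval : ∀ k, (a k : ℝ) * aeval ξ (f k) + b k * aeval ξ (f (k + 1)) +
      c k * aeval ξ (f (k + 2)) = 0 := fun k => by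
    simpa using congrArg (aeval ξ) (hrel k)
  have hDrec : ∀ i j k, c k * D i j (k + 1) = a k * D i j k := fun i j k => by
    simp only [D, add_assoc, Nat.reduceAdd]
    linear_combination (f (k + 1)).coeff i * hcoeff k j - (f (k + 1)).coeff j * hcoeff k i
  have hErec : ∀ j k, (c k : ℝ) * E j (k + 1) = a k * E j k := fun j k => by
    have := hcoeff k j
    have hj : (a k : ℝ) * (f k).coeff j + b k * (f (k + 1)).coeff j +
        c k * (f (k + 2)).coeff j = 0 := by exact_mod_cast this
    simp only [E, add_assoc, Nat.reduceAdd]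
    linear_combination aeval ξ (f (k + 1)) * hj - (f (k + 1)).coeff j * hval k
  have hE0 : ∀ i j, D i j 0 ≠ 0 → E j 0 = 0 := by
    intro i j hD0
    have hinv : ∀ k, E j k * D i j 0 = E j 0 * D i j k ∧ D i j k ≠ 0 := by
      intro k
      induction k with
      | zero => exact ⟨rfl, hD0⟩
      | succ k ih =>
        have hck : (c k : ℝ) ≠ 0 := by exact_mod_cast hc k
        have hDk : (c k : ℝ) * D i j (k + 1) = a k * D i j k := by exact_mod_cast hDrec i j k
        refine ⟨mul_left_cancel₀ hck ?_, fun h0 => ?_⟩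
        · linear_combination (D i j 0 : ℝ) * hErec j k + (a k : ℝ) * ih.1 - E j 0 * hDk
        · have := hDrec i j k
          rw [h0, mul_zero] at this
          exact mul_ne_zero (ha k) ih.2 this.symm
    have hbound : ∀ k, |E j 0| ≤
        2 * (polyHeight (f (k + 1)) * |aeval ξ (f k)|) * |(D i j 0 : ℝ)| := by
      intro k
      have h1 : (1 : ℝ) ≤ |(D i j k : ℝ)| := by
        rw [← Int.cast_abs]
        exact_mod_cast Int.one_le_abs (hinv k).2
      have h2 : |E j k| ≤ 2 * (polyHeight (f (k + 1)) * |aeval ξ (f k)|) := by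
        have h3 : |aeval ξ (f k) * ((f (k + 1)).coeff j : ℝ)| ≤
            |aeval ξ (f k)| * polyHeight (f (k + 1)) := by
          rw [abs_mul]
          gcongr
          exact abs_coeff_le_polyHeight _ _
        have h4 : |aeval ξ (f (k + 1)) * ((f k).coeff j : ℝ)| ≤
            |aeval ξ (f k)| * polyHeight (f (k + 1)) := by
          rw [abs_mul]
          exact mul_le_mul (hL k) ((abs_coeff_le_polyHeight _ _).trans (hH k)) (abs_nonneg _)
            (abs_nonneg _)
        have := abs_sub (aeval ξ (f k) * ((f (k + 1)).coeff j : ℝ))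
          (aeval ξ (f (k + 1)) * ((f k).coeff j : ℝ))
        simp only [E]
        linarith
      calc |E j 0| ≤ |E j 0| * |(D i j k : ℝ)| := le_mul_of_one_le_right (abs_nonneg _) h1
        _ = |E j k| * |(D i j 0 : ℝ)| := by rw [← abs_mul, ← (hinv k).1, abs_mul]
        _ ≤ _ := by gcongr
    have hlim' := (hlim.const_mul 2).mul_const |(D i j 0 : ℝ)|
    rw [mul_zero, zero_mul] at hlim'
    exact abs_nonpos_iff.mp (ge_of_tendsto' hlim' hbound)
  obtain ⟨i, j, hij⟩ : ∃ i j, D i j 0 ≠ 0 := by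
    by_contra! hD
    have hf0 : f 0 ≠ 0 := fun h0 => hξ 0 (by simp [h0])
    refine leadingCoeff_ne_zero.mpr hf0
      (hprop 0 (-(f 1).coeff (f 0).natDegree) (f 0).leadingCoeff ?_)
    ext j
    have := hD (f 0).natDegree j
    simp only [D, zero_add] at this
    simp only [coeff_add, coeff_smul, smul_eq_mul, leadingCoeff, zero_add, coeff_zero]
    linear_combination this
  have hji : D j i 0 ≠ 0 := fun h => hij (by simp only [D] at h ⊢; linear_combination -h)
  have h1 := hE0 i j hij
  have h2 := hE0 j i hji
  have h3 : aeval ξ (f 0) * (D i j 0 : ℝ) = 0 := by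
    simp only [E, D] at h1 h2 ⊢
    push_cast
    linear_combination ((f 0).coeff i : ℝ) * h1 - ((f 0).coeff j : ℝ) * h2
  exact mul_ne_zero (hξ 0) (by exact_mod_cast hij) h3

namespace IsMinimalSeq

theorem isPrimitive {n : ℕ} {ξ : ℝ} {f : ℕ → ℤ[X]} (hf : IsMinimalSeq n ξ f)
    (hξ : ∀ P : ℤ[X], P ≠ 0 → aeval ξ P ≠ 0) (k : ℕ) : (f k).IsPrimitive := by
  have h0 := hf.ne_zero k
  have hmin := hf.abs_aeval_le k (f k).primPart (primPart_ne_zero _)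
    (by rw [natDegree_primPart]; exact hf.natDegree_le k) (polyHeight_primPart_le h0)
  rw [← abs_aeval_primPart_mul ξ (f k)] at hmin
  have hpos : 0 < |aeval ξ (f k).primPart| := abs_pos.mpr (hξ _ (primPart_ne_zero _))
  have hle : |((f k).content : ℝ)| ≤ 1 := (mul_le_iff_le_one_left hpos).mp hmin
  rw [← Int.cast_abs] at hle
  have hunit : IsUnit (f k).content := Int.isUnit_iff_abs_eq.mpr
    (le_antisymm (by exact_mod_cast hle) (Int.one_le_abs (mt content_eq_zero_iff.mp h0)))
  exact fun r hr => isUnit_of_dvd_unit (dvd_content_iff_C_dvd.mpr hr) hunit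

theorem eventually_irreducible {m : ℕ} {ξ y : ℝ} {f : ℕ → ℤ[X]} (hf : IsMinimalSeq (m + 2) ξ f)
    (hξ : ∀ P : ℤ[X], P ≠ 0 → aeval ξ P ≠ 0)
    (hU : ∀ᶠ H : ℝ in atTop, ∃ P : ℤ[X], P.natDegree ≤ m + 2 ∧ polyHeight P ≤ H ∧
      0 < |aeval ξ P| ∧ |aeval ξ P| ≤ H ^ (-y)) (hy : 2 * (m : ℝ) + 2 < y) :
    ∀ᶠ k in atTop, Irreducible (f k) ∧ (f k).natDegree = m + 2 := by
  obtain ⟨w, hw, hwy⟩ := exists_between hy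
  have hw0 : 0 < w := by have := m.cast_nonneg (α := ℝ); linarith
  obtain ⟨c, hc, hlow⟩ := exists_lower_bound_of_natDegree_le hξ hU hw hwy.le (m + 1) le_rfl
  obtain ⟨c', hc', hred⟩ := exists_lower_bound_of_not_irreducible hw0.le hc hlow
  have hsmall : ∀ᶠ H : ℝ in atTop, 2 ^ y * H ^ (-(y - w)) < min c c' := by
    have := (tendsto_rpow_neg_atTop (sub_pos.mpr hwy)).const_mul ((2 : ℝ) ^ y)
    rw [mul_zero] at this
    exact this.eventually_lt_const (by positivity)
  filter_upwards [hf.eventually_abs_aeval_le hU, hf.tendsto_polyHeight.eventually hsmall]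
    with k hk hsm
  have h1 := one_le_polyHeight (hf.ne_zero k)
  have hlt : |aeval ξ (f k)| < min c c' * polyHeight (f k) ^ (-w) := by
    calc |aeval ξ (f k)| ≤ 2 ^ y * polyHeight (f (k + 1)) ^ (-y) := hk
      _ ≤ 2 ^ y * polyHeight (f k) ^ (-y) := by
        gcongr 2 ^ y * ?_
        exact Real.rpow_le_rpow_of_nonpos (by linarith) (hf.polyHeight_lt k).le (by linarith)
      _ = 2 ^ y * polyHeight (f k) ^ (-(y - w)) * polyHeight (f k) ^ (-w) := by
        rw [mul_assoc, ← Real.rpow_add (by linarith)]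
        ring_nf
      _ < _ := by gcongr
  have hrpow : 0 ≤ polyHeight (f k) ^ (-w) := Real.rpow_nonneg (polyHeight_nonneg _) _
  have hdeg : (f k).natDegree = m + 2 := by
    by_contra hne
    have := hf.natDegree_le k
    exact hlt.not_ge ((mul_le_mul_of_nonneg_right (min_le_left _ _) hrpow).trans
      (hlow _ (hf.ne_zero k) (by omega)))
  refine ⟨?_, hdeg⟩
  by_contra hirr
  exact hlt.not_ge ((mul_le_mul_of_nonneg_right (min_le_right _ _) hrpow).trans
    (hred _ (hf.isPrimitive hξ k) hdeg hirr))

theorem not_dvd {n : ℕ} {ξ : ℝ} {f : ℕ → ℤ[X]} (hf : IsMinimalSeq n ξ f) {k : ℕ}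
    (hk : Irreducible (f k)) (hk' : Irreducible (f (k + 1))) : ¬ f k ∣ f (k + 1) := by
  rintro ⟨B, hB⟩
  obtain ⟨r, hr, rfl⟩ := isUnit_iff.mp ((hk'.isUnit_or_isUnit hB).resolve_left hk.not_isUnit)
  have h := hf.abs_aeval_lt k
  rw [hB, map_mul, abs_mul, aeval_C, algebraMap_int_eq, eq_intCast, ← Int.cast_abs,
    Int.isUnit_iff_abs_eq.mp hr, Int.cast_one, mul_one] at h
  exact h.false

end IsMinimalSeq

theorem Irreducible.eq_zero_of_zsmul_add_zsmul_eq_zero {P Q : ℤ[X]} (hP : Irreducible P)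
    (hdeg : P.natDegree ≠ 0) (hPQ : ¬ P ∣ Q) {b c : ℤ} (h : b • P + c • Q = 0) : c = 0 := by
  have hpos : (C c).degree < P.degree :=
    degree_C_le.trans_lt (natDegree_pos_iff_degree_pos.mp (Nat.pos_of_ne_zero hdeg))
  rw [← C_mul', ← C_mul'] at h
  exact C_eq_zero.mp (hP.eq_zero_of_mul_add_mul_eq_zero hPQ hpos h).2

theorem one_le_mul_rpow_of_one_le {A B a b s t M : ℝ} (hA : 0 < A) (ha : 0 < a)
    (hb : 0 < b) (ht : 0 ≤ t) (h1 : 1 ≤ A * b * a ^ (-s)) (h2 : 1 ≤ B * a ^ M * b ^ (-t)) :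
    1 ≤ A ^ t * B * a ^ (-(s * t - M)) := by
  have h3 : 1 ≤ (A * b * a ^ (-s)) ^ t := Real.one_le_rpow h1 ht
  refine (one_le_mul_of_one_le_of_one_le h3 h2).trans_eq ?_
  rw [Real.mul_rpow (by positivity) (by positivity), Real.mul_rpow hA.le hb.le,
    ← Real.rpow_mul ha.le]
  calc A ^ t * b ^ t * a ^ (-s * t) * (B * a ^ M * b ^ (-t))
      = A ^ t * B * (b ^ t * b ^ (-t)) * (a ^ (-s * t) * a ^ M) := by ring
    _ = _ := by
      rw [← Real.rpow_add hb, ← Real.rpow_add ha, add_neg_cancel, Real.rpow_zero, mul_one]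
      ring_nf

open Topology in
theorem mul_le_of_uniform_exponent {m : ℕ} {ξ y : ℝ} (hξ : ∀ P : ℤ[X], P ≠ 0 → aeval ξ P ≠ 0)
    (hU : ∀ᶠ H : ℝ in atTop, ∃ P : ℤ[X], P.natDegree ≤ m + 2 ∧ polyHeight P ≤ H ∧
      0 < |aeval ξ P| ∧ |aeval ξ P| ≤ H ^ (-y)) (hy : 2 * (m : ℝ) + 2 < y) :
    (y - (2 * m + 1)) * (y - (m + 2)) ≤ m + 1 := by
  have hm : (0 : ℝ) ≤ m := m.cast_nonneg
  by_contra! hst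
  obtain ⟨f, hf⟩ : ∃ f, IsMinimalSeq (m + 2) ξ f := by
    refine exists_isMinimalSeq hξ fun v hv => ?_
    obtain ⟨H, ⟨P, hPd, -, hPpos, hPle⟩, hHv⟩ := (hU.and
      ((tendsto_rpow_neg_atTop (show 0 < y by linarith)).eventually_lt_const hv)).exists
    exact ⟨P, by rintro rfl; simp at hPpos, hPd, hPle.trans_lt hHv⟩
  obtain ⟨C₁, hC₁, htriple⟩ := exists_triple_bound m ξ
  obtain ⟨C₂, hC₂, hres⟩ := exists_resultant_bound (m + 1) ξ
  have h2y : (0 : ℝ) < 2 ^ y := by positivity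
  have hpos : ∀ k, 0 < polyHeight (f k) := fun k =>
    zero_lt_one.trans_le (one_le_polyHeight (hf.ne_zero k))
  have hsmall : ∀ᶠ a : ℝ in atTop, (C₁ * 2 ^ y) ^ (y - (m + 2)) * (2 * C₂ * 2 ^ y) *
      a ^ (-((y - (2 * m + 1)) * (y - (m + 2)) - (m + 1))) < 1 := by
    have := (tendsto_rpow_neg_atTop (sub_pos.mpr hst)).const_mul
      ((C₁ * 2 ^ y) ^ (y - (m + 2)) * (2 * C₂ * 2 ^ y))
    rw [mul_zero] at this
    exact this.eventually_lt_const one_pos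
  have hf1 := (tendsto_add_atTop_iff_nat 1).mpr hf.tendsto_polyHeight
  obtain ⟨K, hK⟩ := eventually_atTop.mp ((hf.eventually_irreducible hξ hU hy).and
    ((hf.eventually_abs_aeval_le hU).and (hf1.eventually hsmall)))
  have hlim : Tendsto (fun k => polyHeight (f (k + 1)) * |aeval ξ (f k)|) atTop (𝓝 0) := by
    have h0 := ((tendsto_rpow_neg_atTop (show 0 < y - 1 by linarith)).comp hf1).const_mul
      ((2 : ℝ) ^ y)
    rw [mul_zero] at h0
    refine squeeze_zero' (.of_forall fun k => mul_nonneg (hpos _).le (abs_nonneg _)) ?_ h0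
    filter_upwards [hf.eventually_abs_aeval_le hU] with k hk
    calc polyHeight (f (k + 1)) * |aeval ξ (f k)|
        ≤ polyHeight (f (k + 1)) * (2 ^ y * polyHeight (f (k + 1)) ^ (-y)) := by
          gcongr; exact (hpos _).le
      _ = 2 ^ y * polyHeight (f (k + 1)) ^ (-(y - 1)) := by
          rw [neg_sub, sub_eq_add_neg, Real.rpow_add (hpos _), Real.rpow_one]
          ring
  have hndvd : ∀ k, K ≤ k → ¬ f k ∣ f (k + 1) := fun k hk =>
    hf.not_dvd (hK k hk).1.1 (hK (k + 1) (by omega)).1.1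
  obtain ⟨j, hj⟩ := exists_independent_triple (f := fun k => f (k + K)) (ξ := ξ)
    (fun k => hξ _ (hf.ne_zero _))
    (fun k b c h => by
      have hk := (hK (k + K) (by omega)).1
      rw [add_right_comm] at h
      exact hk.1.eq_zero_of_zsmul_add_zsmul_eq_zero (by omega) (hndvd _ (by omega)) h)
    (fun k => by rw [add_right_comm]; exact (hf.polyHeight_lt _).le)
    (fun k => by rw [add_right_comm]; exact (hf.abs_aeval_lt _).le)
    (by
      have := (tendsto_add_atTop_iff_nat K).mpr hlim
      simpa only [add_right_comm] using this)
  obtain ⟨k, hkK, hj⟩ : ∃ k, K ≤ k ∧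
      ∀ a b c : ℤ, a • f k + b • f (k + 1) + c • f (k + 2) = 0 → c = 0 :=
    ⟨j + K, by omega, by simpa only [add_right_comm] using hj⟩
  obtain ⟨⟨hirr, hdeg⟩, hL, hsm⟩ := hK k (by omega)
  obtain ⟨⟨hirr', hdeg'⟩, hL', -⟩ := hK (k + 1) (by omega)
  rw [add_assoc k, one_add_one_eq_two] at hL'
  have hab := (hf.polyHeight_lt (k + 1)).le
  have hval := (hf.abs_aeval_lt (k + 1)).le
  have hval0 := (hf.abs_aeval_lt k).le
  rw [add_assoc k, one_add_one_eq_two] at hab hval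
  have h1 := htriple _ _ _ hirr hdeg (hf.natDegree_le (k + 1)) (hf.natDegree_le (k + 2))
    (hndvd k (by omega)) hj (hf.polyHeight_lt k).le hab hval0 (hval.trans hval0)
  have h2 := hres (m + 1) _ _ hirr' hdeg' le_rfl (hf.natDegree_le (k + 2))
    (hndvd (k + 1) (by omega))
  have ha := hpos (k + 1)
  have hb := hpos (k + 2)
  refine hsm.not_ge (one_le_mul_rpow_of_one_le (b := polyHeight (f (k + 2))) (by positivity)
    ha hb (by linarith) ?_ ?_)
  · refine h1.trans ?_
    calc _ ≤ C₁ * (polyHeight (f (k + 2)) * polyHeight (f (k + 1)) ^ (2 * m + 1) *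
          (2 ^ y * polyHeight (f (k + 1)) ^ (-y))) := by gcongr
      _ = C₁ * 2 ^ y * polyHeight (f (k + 2)) * (polyHeight (f (k + 1)) ^ (2 * m + 1) *
          polyHeight (f (k + 1)) ^ (-y)) := by ring
      _ = _ := by
        rw [← Real.rpow_natCast, ← Real.rpow_add ha]
        push_cast
        ring_nf
  · refine h2.trans ?_
    calc _ ≤ C₂ * (polyHeight (f (k + 1)) ^ (m + 1) * polyHeight (f (k + 2)) ^ (m + 1 + 1) *
            (2 ^ y * polyHeight (f (k + 2)) ^ (-y)) +
          polyHeight (f (k + 1)) ^ (m + 1) * polyHeight (f (k + 2)) ^ (m + 1 + 1) *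
            (2 ^ y * polyHeight (f (k + 2)) ^ (-y))) := by
          gcongr C₂ * (?_ + ?_)
          · gcongr
          · rw [pow_succ _ (m + 1), pow_succ _ (m + 1), mul_right_comm (_ ^ (m + 1)),
              ← mul_assoc (_ ^ (m + 1))]
            gcongr ?_ * ?_ * ?_
            exact hval.trans hL'
      _ = 2 * C₂ * 2 ^ y * polyHeight (f (k + 1)) ^ (m + 1) *
          (polyHeight (f (k + 2)) ^ (m + 1 + 1) * polyHeight (f (k + 2)) ^ (-y)) := by ring
      _ = _ := by
        rw [← Real.rpow_natCast, ← Real.rpow_natCast, ← Real.rpow_add hb]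
        push_cast
        ring_nf

theorem aeval_int_ne_zero_of_transcendental {ξ : ℝ} (hξ : Transcendental ℚ ξ) {P : ℤ[X]}
    (hP : P ≠ 0) : aeval ξ P ≠ 0 := fun h =>
  hξ ((IsFractionRing.isAlgebraic_iff ℤ ℚ ℝ).mp ⟨P, hP, h⟩)

theorem stmt5 (n : ℕ) (hn : 2 ≤ n) (ξ : ℝ) (hξ : Transcendental ℚ ξ) :
    whExp n ξ ≤ (((n : ℝ) - 1 / 2 + Real.sqrt ((n : ℝ) ^ 2 - 2 * n + 5 / 4) : ℝ) : EReal) := by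
  refine sSup_le ?_
  rintro x ⟨w, rfl, hw⟩
  rw [EReal.coe_le_coe_iff]
  by_contra! hlt
  obtain ⟨m, rfl⟩ := Nat.exists_eq_add_of_le' hn
  have hm : (0 : ℝ) ≤ m := m.cast_nonneg
  push_cast at hlt
  have hlow : (m : ℝ) + 1 / 2 ≤ √(((m : ℝ) + 2) ^ 2 - 2 * (m + 2) + 5 / 4) :=
    Real.le_sqrt_of_sq_le (by nlinarith)
  have hsq := (Real.sqrt_lt' (show 0 < w - ((m : ℝ) + 2 - 1 / 2) by linarith)).mp
    (show √(((m : ℝ) + 2) ^ 2 - 2 * (m + 2) + 5 / 4) < _ by linarith)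
  have hwm : 2 * (m : ℝ) + 2 < w := by linarith
  have hcore := mul_le_of_uniform_exponent (fun P hP => aeval_int_ne_zero_of_transcendental hξ hP) hw hwm
  nlinarith [mul_nonneg hm (sub_nonneg.mpr hwm.le)]
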